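/- arXiv:2003.02815 — 6 statements merged into one kernel-verified Lean document; each statement's English description precedes it below -/
import Mathlib

section
/- Let N̂ be a smooth vectorfield on U with g(N̂,N̂) = -1, set Π̃^α_β := δ^α_β + N̂^α N̂_β and (g̃^{-1})^{αβ} := (g^{-1})^{αβ} + N̂^α N̂^β, and let J be a smooth vectorfield on U with g(J,N̂) = 0 everywhere. Then at every point of U the projected covariant divergence of J satisfies: Π̃^γ_δ D_γ J^δ = ∂_α J^α - J_α (N̂^μ ∂_μ N̂^α) - (N̂^μ ∂_μ g_{αβ}) J^α N̂^β + (1/2)(g̃^{-1})^{αβ} (J^μ ∂_μ g_{αβ}), where J_α := g_{αβ} J^β. -/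
noncomputable section

open scoped BigOperators

/-- The set of spatial indices `{1,2,3} ⊆ Fin 4`. -/
def spIdx : Finset (Fin 4) := {1, 2, 3}

/-- The components `g_{αβ}` of the acoustical metric determined by the sound
speed `c` and the velocity components `v` at a point (recall `v 0 = 0`):
`g_{00} = -1 + c⁻² Σₐ (vᵃ)²`, `g_{0i} = g_{i0} = -c⁻² vⁱ`, `g_{ij} = c⁻² δ_{ij}`. -/
def gmet (c : ℝ) (v : Fin 4 → ℝ) (α β : Fin 4) : ℝ :=
  if α = 0 then
    if β = 0 then -1 + (∑ a ∈ spIdx, v a ^ 2) / c ^ 2 else -v β / c ^ 2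
  else
    if β = 0 then -v α / c ^ 2 else (if α = β then (1 : ℝ) else 0) / c ^ 2

/-- The components of the inverse acoustical metric:
`G^{00} = -1`, `G^{0i} = G^{i0} = -vⁱ`, `G^{ij} = c² δ^{ij} - vⁱ vʲ`. -/
def ginv (c : ℝ) (v : Fin 4 → ℝ) (α β : Fin 4) : ℝ :=
  if α = 0 then
    if β = 0 then -1 else -v β
  else
    if β = 0 then -v α else c ^ 2 * (if α = β then (1 : ℝ) else 0) - v α * v β

/-- The material vectorfield `B = (1, v¹, v², v³)` (recall `v 0 = 0`). -/
def Bvec (v : Fin 4 → ℝ) (α : Fin 4) : ℝ := (if α = 0 then (1 : ℝ) else 0) + v α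

/-- The inner product `g(X,Y) = g_{αβ} X^α Y^β`. -/
def gip (c : ℝ) (v : Fin 4 → ℝ) (X Y : Fin 4 → ℝ) : ℝ :=
  ∑ α : Fin 4, ∑ β : Fin 4, gmet c v α β * X α * Y β

/-- Index lowering with `g`:  `X_α = g_{αβ} X^β`. -/
def glow (c : ℝ) (v : Fin 4 → ℝ) (X : Fin 4 → ℝ) (α : Fin 4) : ℝ :=
  ∑ β : Fin 4, gmet c v α β * X β

/-- The partial derivative `∂_α f` at `x`. -/
def pd (f : (Fin 4 → ℝ) → ℝ) (α : Fin 4) (x : Fin 4 → ℝ) : ℝ :=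
  fderiv ℝ f x (Pi.single α 1)

/-- The totally antisymmetric symbol `ε_{αβγδ}`, normalized by `ε_{0123} = 1`. -/
def eps4 (α β γ δ : Fin 4) : ℝ :=
  (((β : ℕ) : ℝ) - ((α : ℕ) : ℝ)) * (((γ : ℕ) : ℝ) - ((α : ℕ) : ℝ)) *
    (((δ : ℕ) : ℝ) - ((α : ℕ) : ℝ)) * (((γ : ℕ) : ℝ) - ((β : ℕ) : ℝ)) *
    (((δ : ℕ) : ℝ) - ((β : ℕ) : ℝ)) * (((δ : ℕ) : ℝ) - ((γ : ℕ) : ℝ)) / 12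

/-- The spatial totally antisymmetric symbol `ε_{ijk}` (vanishing unless all
indices lie in `{1,2,3}`), normalized by `ε_{123} = 1`. -/
def eps3 (i j k : Fin 4) : ℝ := eps4 0 i j k

/-- The acoustical metric components as functions of the point. -/
def gmetP (c : (Fin 4 → ℝ) → ℝ) (v : (Fin 4 → ℝ) → Fin 4 → ℝ) (α β : Fin 4)
    (x : Fin 4 → ℝ) : ℝ :=
  gmet (c x) (v x) α β

/-- The Christoffel symbols
`Γ_β{}^α{}_γ = (1/2)(g⁻¹)^{ακ}(∂_β g_{κγ} + ∂_γ g_{βκ} - ∂_κ g_{βγ})`. -/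
def Chr (c : (Fin 4 → ℝ) → ℝ) (v : (Fin 4 → ℝ) → Fin 4 → ℝ) (β α γ : Fin 4)
    (x : Fin 4 → ℝ) : ℝ :=
  (1 / 2) * ∑ κ : Fin 4, ginv (c x) (v x) α κ *
    (pd (gmetP c v κ γ) β x + pd (gmetP c v β κ) γ x - pd (gmetP c v β γ) κ x)

/-- The Levi-Civita covariant derivative `D_β J^α = ∂_β J^α + Γ_β{}^α{}_γ J^γ`. -/
def Dcov (c : (Fin 4 → ℝ) → ℝ) (v J : (Fin 4 → ℝ) → Fin 4 → ℝ) (β α : Fin 4)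
    (x : Fin 4 → ℝ) : ℝ :=
  pd (fun y => J y α) β x + ∑ γ : Fin 4, Chr c v β α γ x * J x γ

lemma gmet_symm (c : ℝ) (v : Fin 4 → ℝ) (α β : Fin 4) : gmet c v α β = gmet c v β α := by
  fin_cases α <;> fin_cases β <;> simp [gmet]

lemma ginv_symm (c : ℝ) (v : Fin 4 → ℝ) (α β : Fin 4) : ginv c v α β = ginv c v β α := by
  fin_cases α <;> fin_cases β <;> simp [ginv, mul_comm]

/-- Raising a lowered index gives back the original vector. -/
lemma sum_glow_mul_ginv {c : ℝ} (hc : c ≠ 0) (v X : Fin 4 → ℝ)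
    (κ : Fin 4) : ∑ δ, glow c v X δ * ginv c v δ κ = X κ := by
  fin_cases κ <;>
    simp [glow, gmet, ginv, spIdx, Fin.sum_univ_four] <;> field_simp <;> ring

lemma sum_projection_mul_ginv {c : ℝ} (hc : c ≠ 0) (v X : Fin 4 → ℝ)
    (γ κ : Fin 4) :
    ∑ δ, ((if γ = δ then (1 : ℝ) else 0) + X γ * glow c v X δ) * ginv c v δ κ
      = ginv c v γ κ + X γ * X κ := by
  simp only [add_mul, Finset.sum_add_distrib, ite_mul, one_mul, zero_mul, mul_assoc,
    ← Finset.mul_sum, sum_glow_mul_ginv hc]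
  simp

lemma differentiableAt_gmetP {c : (Fin 4 → ℝ) → ℝ} {v : (Fin 4 → ℝ) → Fin 4 → ℝ}
    {x : Fin 4 → ℝ} (hc : DifferentiableAt ℝ c x) (hv : DifferentiableAt ℝ v x) (h : c x ≠ 0)
    (α β : Fin 4) : DifferentiableAt ℝ (gmetP c v α β) x := by
  have hv' : ∀ a, DifferentiableAt ℝ (fun y => v y a) x := differentiableAt_pi.1 hv
  have h2 : c x ^ 2 ≠ 0 := pow_ne_zero 2 h
  unfold gmetP gmet
  split_ifs <;> fun_prop (disch := assumption)

/-- The Leibniz rule for a partial derivative of `g(X,Y)`. -/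
lemma pd_gip {c : (Fin 4 → ℝ) → ℝ} {v X Y : (Fin 4 → ℝ) → Fin 4 → ℝ} {x : Fin 4 → ℝ}
    (hg : ∀ α β, DifferentiableAt ℝ (gmetP c v α β) x)
    (hX : DifferentiableAt ℝ X x) (hY : DifferentiableAt ℝ Y x) (μ : Fin 4) :
    pd (fun y => gip (c y) (v y) (X y) (Y y)) μ x
      = ∑ α, ∑ β, (pd (gmetP c v α β) μ x * X x α * Y x β
          + gmet (c x) (v x) α β * pd (fun y => X y α) μ x * Y x β
          + gmet (c x) (v x) α β * X x α * pd (fun y => Y y β) μ x) := by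
  have hX' := fun a => (differentiableAt_pi.1 hX a).hasFDerivAt
  have hY' := fun a => (differentiableAt_pi.1 hY a).hasFDerivAt
  have key := HasFDerivAt.fun_sum (u := Finset.univ) fun α _ =>
    HasFDerivAt.fun_sum (u := Finset.univ) fun β _ =>
      ((hg α β).hasFDerivAt.mul (hX' α)).mul (hY' β)
  have e : (fun y => gip (c y) (v y) (X y) (Y y)) = fun y => ∑ α, ∑ β,
      (gmetP c v α β * (fun y => X y α) * fun y => Y y β) y := rfl
  rw [pd, e, key.fderiv]
  simp only [sum_apply, add_apply, smul_apply, smul_eq_mul, pd, Pi.mul_apply, gmetP]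
  refine Finset.sum_congr rfl fun α _ => Finset.sum_congr rfl fun β _ => ?_
  ring

/-- Contracting Christoffel-type combinations with a symmetric tensor `S`
leaves only one of the three terms. -/
lemma sum_symm_mul_christoffel {ι : Type*} [Fintype ι] {S : ι → ι → ℝ} {D : ι → ι → ι → ℝ}
    (hS : ∀ α β, S α β = S β α) (J : ι → ℝ) :
    ∑ γ, ∑ κ, S γ κ * ∑ α, (D κ α γ + D γ κ α - D γ α κ) * J α
      = ∑ α, ∑ β, S α β * ∑ μ, J μ * D α β μ := by
  have h : ∑ γ, ∑ κ, S γ κ * ∑ α, D κ α γ * J α = ∑ γ, ∑ κ, S γ κ * ∑ α, D γ α κ * J α := by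
    rw [Finset.sum_comm]
    exact Finset.sum_congr rfl fun κ _ => Finset.sum_congr rfl fun γ _ => by rw [hS]
  simp only [sub_mul, add_mul, Finset.sum_add_distrib, Finset.sum_sub_distrib, mul_add, mul_sub, h,
    mul_comm (J _)]
  ring

/-- The Christoffel part of the projected divergence. -/
lemma sum_projection_mul_Chr {c : (Fin 4 → ℝ) → ℝ} {v : (Fin 4 → ℝ) → Fin 4 → ℝ}
    {x : Fin 4 → ℝ} (hc : c x ≠ 0) (N J : Fin 4 → ℝ) :
    ∑ γ, ∑ δ, ((if γ = δ then (1 : ℝ) else 0) + N γ * glow (c x) (v x) N δ) *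
        ∑ α, Chr c v γ δ α x * J α
      = (1 / 2) * ∑ α, ∑ β, (ginv (c x) (v x) α β + N α * N β) *
          ∑ μ, J μ * pd (gmetP c v α β) μ x := by
  rw [← sum_symm_mul_christoffel (S := fun α β => ginv (c x) (v x) α β + N α * N β)
    (D := fun α β μ => pd (gmetP c v α β) μ x)
    (fun α β => by rw [ginv_symm, mul_comm (N α)]), Finset.mul_sum]
  refine Finset.sum_congr rfl fun γ _ => ?_
  simp only [← sum_projection_mul_ginv hc, Chr, Finset.mul_sum, Finset.sum_mul]
  rw [Finset.sum_congr rfl fun δ _ => Finset.sum_comm, Finset.sum_comm]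
  refine Finset.sum_congr rfl fun κ _ => ?_
  rw [Finset.sum_comm]
  refine Finset.sum_congr rfl fun α _ => Finset.sum_congr rfl fun δ _ => ?_
  ring

/-- Differentiating `g(X,Y) = 0` moves the derivative from `X` onto `Y` and the metric. -/
lemma sum_glow_mul_pd_of_gip_eq_zero {c : (Fin 4 → ℝ) → ℝ}
    {v X Y : (Fin 4 → ℝ) → Fin 4 → ℝ} {x : Fin 4 → ℝ}
    (hg : ∀ α β, DifferentiableAt ℝ (gmetP c v α β) x)
    (hX : DifferentiableAt ℝ X x) (hY : DifferentiableAt ℝ Y x)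
    (h : ∀ᶠ y in nhds x, gip (c y) (v y) (X y) (Y y) = 0) (μ : Fin 4) :
    ∑ δ, glow (c x) (v x) (Y x) δ * pd (fun y => X y δ) μ x
      = -(∑ α, glow (c x) (v x) (X x) α * pd (fun y => Y y α) μ x)
        - ∑ α, ∑ β, pd (gmetP c v α β) μ x * X x α * Y x β := by
  have h0 : pd (fun y => gip (c y) (v y) (X y) (Y y)) μ x = 0 := by
    have e : (fun y => gip (c y) (v y) (X y) (Y y)) =ᶠ[nhds x] fun _ => (0 : ℝ) := h
    rw [pd, e.fderiv_eq]
    simp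
  rw [pd_gip hg hX hY] at h0
  simp only [Finset.sum_add_distrib] at h0
  have h1 : ∑ δ, glow (c x) (v x) (Y x) δ * pd (fun y => X y δ) μ x
      = ∑ α, ∑ β, gmet (c x) (v x) α β * pd (fun y => X y α) μ x * Y x β := by
    simp only [glow, Finset.sum_mul, mul_right_comm]
  have h2 : ∑ α, glow (c x) (v x) (X x) α * pd (fun y => Y y α) μ x
      = ∑ α, ∑ β, gmet (c x) (v x) α β * X x α * pd (fun y => Y y β) μ x := by
    rw [Finset.sum_comm]
    simp only [glow, Finset.sum_mul]
    exact Finset.sum_congr rfl fun β _ => Finset.sum_congr rfl fun α _ => by rw [gmet_symm]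
  linarith

/-- The projected covariant divergence of a vectorfield `J`
that is `g`-orthogonal to the unit timelike vectorfield `N̂` satisfies
`Π̃^γ_δ D_γ J^δ = ∂_α J^α - J_α (N̂^μ ∂_μ N̂^α) - (N̂^μ ∂_μ g_{αβ}) J^α N̂^β
 + (1/2)(g̃⁻¹)^{αβ} (J^μ ∂_μ g_{αβ})`. -/
theorem stmt4_projected_covariant_divergence_identity
    (U : Set (Fin 4 → ℝ)) (hUopen : IsOpen U) (hUne : U.Nonempty)
    (v : (Fin 4 → ℝ) → Fin 4 → ℝ) (c : (Fin 4 → ℝ) → ℝ)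
    (hv : ContDiffOn ℝ (⊤ : ℕ∞) v U) (hc : ContDiffOn ℝ (⊤ : ℕ∞) c U)
    (hv0 : ∀ x, v x 0 = 0) (hcpos : ∀ x ∈ U, 0 < c x)
    (Nh J : (Fin 4 → ℝ) → Fin 4 → ℝ)
    (hNh : ContDiffOn ℝ (⊤ : ℕ∞) Nh U) (hJ : ContDiffOn ℝ (⊤ : ℕ∞) J U)
    (hNhUnit : ∀ x ∈ U, gip (c x) (v x) (Nh x) (Nh x) = -1)
    (hJtan : ∀ x ∈ U, gip (c x) (v x) (J x) (Nh x) = 0) :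
    ∀ x ∈ U,
      (∑ γ : Fin 4, ∑ δ : Fin 4,
        ((if γ = δ then (1 : ℝ) else 0) + Nh x γ * glow (c x) (v x) (Nh x) δ) *
          Dcov c v J γ δ x)
      = (∑ α : Fin 4, pd (fun y => J y α) α x)
        - (∑ α : Fin 4, glow (c x) (v x) (J x) α *
            ∑ μ : Fin 4, Nh x μ * pd (fun y => Nh y α) μ x)
        - (∑ α : Fin 4, ∑ β : Fin 4,
            (∑ μ : Fin 4, Nh x μ * pd (gmetP c v α β) μ x) * J x α * Nh x β)
        + (1 / 2) * ∑ α : Fin 4, ∑ β : Fin 4,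
            (ginv (c x) (v x) α β + Nh x α * Nh x β) *
              ∑ μ : Fin 4, J x μ * pd (gmetP c v α β) μ x := by
  intro x hx
  have hU := hUopen.mem_nhds hx
  have hcx : c x ≠ 0 := (hcpos x hx).ne'
  have dv := (hv.contDiffAt hU).differentiableAt (by simp)
  have dc := (hc.contDiffAt hU).differentiableAt (by simp)
  have dN := (hNh.contDiffAt hU).differentiableAt (by simp)
  have dJ := (hJ.contDiffAt hU).differentiableAt (by simp)
  have key := sum_glow_mul_pd_of_gip_eq_zero (differentiableAt_gmetP dc dv hcx) dJ dN
    (Filter.eventually_of_mem hU hJtan)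
  simp only [Dcov, mul_add, Finset.sum_add_distrib,
    sum_projection_mul_Chr hcx (Nh x) (J x)]
  have hdiv : ∑ γ, ∑ δ, ((if γ = δ then (1 : ℝ) else 0) + Nh x γ * glow (c x) (v x) (Nh x) δ) *
        pd (fun y => J y δ) γ x
      = (∑ α, pd (fun y => J y α) α x)
        + ∑ γ, Nh x γ * ∑ δ, glow (c x) (v x) (Nh x) δ * pd (fun y => J y δ) γ x := by
    simp [add_mul, Finset.sum_add_distrib, mul_assoc, Finset.mul_sum]
  have hJN : ∑ γ, Nh x γ * ∑ α, glow (c x) (v x) (J x) α * pd (fun y => Nh y α) γ x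
      = ∑ α, glow (c x) (v x) (J x) α * ∑ μ, Nh x μ * pd (fun y => Nh y α) μ x := by
    simp only [Finset.mul_sum]
    rw [Finset.sum_comm]
    simp only [mul_left_comm]
  have hg : ∑ γ, Nh x γ * ∑ α, ∑ β, pd (gmetP c v α β) γ x * J x α * Nh x β
      = ∑ α, ∑ β, (∑ μ, Nh x μ * pd (gmetP c v α β) μ x) * J x α * Nh x β := by
    simp only [Finset.mul_sum, Finset.sum_mul]
    rw [Finset.sum_comm_cycle, Finset.sum_comm_cycle]
    simp only [mul_assoc]
  rw [hdiv]
  simp only [key, mul_sub, mul_neg, Finset.sum_sub_distrib, Finset.sum_neg_distrib, hJN, hg]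
  ring
end
end

section
/- Let N be a smooth vectorfield on U with g(N,B) = -1 and g(N,N) < 0 everywhere; set ν := √(-g(N,N)), N̂ := N/ν, Π̃^α_β := δ^α_β + N̂^α N̂_β, and K := ν B - N̂. Then for every smooth Σ_t-tangent vectorfield V on U (i.e., V^0 ≡ 0), at every point of U: Π̃^α_β ∂_α V^β = Σ_{a=1}^{3} ∂_a V^a + K_α (K^μ ∂_μ V^α) - ν K_α (B^μ ∂_μ V^α), where K_α := g_{αβ} K^β. -/
noncomputable section

open scoped BigOperators

/-- `ν = √(-g(N,N))`. -/
def nuP (c : ℝ) (v N : Fin 4 → ℝ) : ℝ := Real.sqrt (-gip c v N N)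

/-- The unit normal `N̂ = N/ν`. -/
def nhat (c : ℝ) (v N : Fin 4 → ℝ) (α : Fin 4) : ℝ := N α / nuP c v N

/-- The first fundamental form `g̃_{αβ} = g_{αβ} + N̂_α N̂_β`. -/
def gtmet (c : ℝ) (v N : Fin 4 → ℝ) (α β : Fin 4) : ℝ :=
  gmet c v α β + glow c v (nhat c v N) α * glow c v (nhat c v N) β

/-- The inverse first fundamental form `(g̃⁻¹)^{αβ} = (g⁻¹)^{αβ} + N̂^α N̂^β`. -/
def gtinv (c : ℝ) (v N : Fin 4 → ℝ) (α β : Fin 4) : ℝ :=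
  ginv c v α β + nhat c v N α * nhat c v N β

/-- The projection `Π̃^α_β = δ^α_β + N̂^α N̂_β`. -/
def projT (c : ℝ) (v N : Fin 4 → ℝ) (α β : Fin 4) : ℝ :=
  (if α = β then (1 : ℝ) else 0) + nhat c v N α * glow c v (nhat c v N) β

/-- The vectorfield `K = νB - N̂`. -/
def Kvec (c : ℝ) (v N : Fin 4 → ℝ) (α : Fin 4) : ℝ :=
  nuP c v N * Bvec v α - nhat c v N α

/-- The projection `(Π̃U)^δ{}_γ = Π̃^δ_β Π̃^α_γ U^β{}_α` of a `(1,1)`-array. -/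
def projMat (c : ℝ) (v N : Fin 4 → ℝ) (M : Matrix (Fin 4) (Fin 4) ℝ) (δ γ : Fin 4) : ℝ :=
  ∑ β : Fin 4, ∑ α : Fin 4, projT c v N δ β * projT c v N α γ * M β α

/-- The squared seminorm `|T|²_g̃ = g̃_{δκ} (g̃⁻¹)^{γμ} T^δ{}_γ T^κ{}_μ`. -/
def gtNormSq (c : ℝ) (v N : Fin 4 → ℝ) (T : Fin 4 → Fin 4 → ℝ) : ℝ :=
  ∑ δ : Fin 4, ∑ κ : Fin 4, ∑ γ : Fin 4, ∑ μ : Fin 4,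
    gtmet c v N δ κ * gtinv c v N γ μ * T δ γ * T κ μ

/-- The solution-adapted quadratic form `Q` acting on `(1,1)`-arrays
`U^β{}_α` (encoded as `M β α`):
`Q(U,U) = |Π̃U|²_g̃ - (K_β K^α U^β{}_α)² + g̃_{γδ}(B^αU^γ{}_α)(B^βU^δ{}_β)
 + (g̃⁻¹)^{αβ}(B_γU^γ{}_α)(B_δU^δ{}_β) + (B_βB^αU^β{}_α)²`. -/
def Qform (c : ℝ) (v N : Fin 4 → ℝ) (M : Matrix (Fin 4) (Fin 4) ℝ) : ℝ :=
  gtNormSq c v N (projMat c v N M)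
  - (∑ β : Fin 4, ∑ α : Fin 4, glow c v (Kvec c v N) β * Kvec c v N α * M β α) ^ 2
  + (∑ γ : Fin 4, ∑ δ : Fin 4, gtmet c v N γ δ *
      (∑ α : Fin 4, Bvec v α * M γ α) * (∑ β : Fin 4, Bvec v β * M δ β))
  + (∑ α : Fin 4, ∑ β : Fin 4, gtinv c v N α β *
      (∑ γ : Fin 4, glow c v (Bvec v) γ * M γ α) *
      (∑ δ : Fin 4, glow c v (Bvec v) δ * M δ β))
  + (∑ β : Fin 4, ∑ α : Fin 4, glow c v (Bvec v) β * Bvec v α * M β α) ^ 2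

/-- Lowering the index of the material vectorfield gives `-dt`. -/
theorem glow_Bvec (c : ℝ) {v : Fin 4 → ℝ} (hv : v 0 = 0) (α : Fin 4) :
    glow c v (Bvec v) α = if α = 0 then -1 else 0 := by
  fin_cases α <;> simp [glow, gmet, Bvec, spIdx, Fin.sum_univ_four, hv] <;> ring

/-- The lowered components of `K = νB - N̂`. -/
theorem glow_Kvec (c : ℝ) {v : Fin 4 → ℝ} (hv : v 0 = 0) (N : Fin 4 → ℝ) (α : Fin 4) :
    glow c v (Kvec c v N) α =
      nuP c v N * (if α = 0 then -1 else 0) - glow c v (nhat c v N) α := by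
  rw [← glow_Bvec c hv]
  simp only [glow, Kvec, Finset.mul_sum, ← Finset.sum_sub_distrib]
  exact Finset.sum_congr rfl fun _ _ => by ring

/-- The partial derivatives at a point of an open set of a function vanishing on that set. -/
theorem pd_eq_zero_of_isOpen {U : Set (Fin 4 → ℝ)} (hU : IsOpen U) {f : (Fin 4 → ℝ) → ℝ}
    (hf : ∀ x ∈ U, f x = 0) {x : Fin 4 → ℝ} (hx : x ∈ U) (α : Fin 4) : pd f α x = 0 := by
  have h : f =ᶠ[nhds x] fun _ => (0 : ℝ) := Filter.mem_of_superset (hU.mem_nhds hx) hf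
  simp [pd, h.fderiv_eq]

/-- For every smooth `Σ_t`-tangent vectorfield `V`:
`Π̃^α_β ∂_α V^β = Σₐ ∂ₐVᵃ + K_α(K^μ∂_μV^α) - ν K_α(B^μ∂_μV^α)`. -/
theorem stmt7_projected_coordinate_divergence_identity
    (U : Set (Fin 4 → ℝ)) (hUopen : IsOpen U) (hUne : U.Nonempty)
    (v : (Fin 4 → ℝ) → Fin 4 → ℝ) (c : (Fin 4 → ℝ) → ℝ)
    (hv : ContDiffOn ℝ (⊤ : ℕ∞) v U) (hc : ContDiffOn ℝ (⊤ : ℕ∞) c U)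
    (hv0 : ∀ x, v x 0 = 0) (hcpos : ∀ x ∈ U, 0 < c x)
    (N : (Fin 4 → ℝ) → Fin 4 → ℝ) (hN : ContDiffOn ℝ (⊤ : ℕ∞) N U)
    (hNB : ∀ x ∈ U, gip (c x) (v x) (N x) (Bvec (v x)) = -1)
    (hNN : ∀ x ∈ U, gip (c x) (v x) (N x) (N x) < 0)
    (V : (Fin 4 → ℝ) → Fin 4 → ℝ) (hV : ContDiffOn ℝ (⊤ : ℕ∞) V U)
    (hV0 : ∀ x ∈ U, V x 0 = 0) :
    ∀ x ∈ U,
      (∑ α : Fin 4, ∑ β : Fin 4,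
        projT (c x) (v x) (N x) α β * pd (fun y => V y β) α x)
      = (∑ a ∈ spIdx, pd (fun y => V y a) a x)
        + (∑ α : Fin 4, glow (c x) (v x) (Kvec (c x) (v x) (N x)) α *
            ∑ μ : Fin 4, Kvec (c x) (v x) (N x) μ * pd (fun y => V y α) μ x)
        - nuP (c x) (v x) (N x) *
            ∑ α : Fin 4, glow (c x) (v x) (Kvec (c x) (v x) (N x)) α *
              ∑ μ : Fin 4, Bvec (v x) μ * pd (fun y => V y α) μ x := by
  intro x hx
  have h0 : ∀ μ, pd (fun y => V y 0) μ x = 0 := pd_eq_zero_of_isOpen hUopen hV0 hx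
  simp only [glow_Kvec (c x) (hv0 x) (N x), projT, Kvec]
  simp [Fin.sum_univ_four, spIdx, h0]
  ring
end
end

section
/- Fix a point of U and let N ∈ ℝ^4 satisfy g(N,B) = -1 and g(N,N) < 0; define ν := √(-g(N,N)), N̂ := N/ν, Π̃^α_β := δ^α_β + N̂^α N̂_β, g̃_{αβ} := g_{αβ} + N̂_α N̂_β, (g̃^{-1})^{αβ} := (g^{-1})^{αβ} + N̂^α N̂^β, and K := ν B - N̂. For a real 4×4 array U = (U^β{}_α), define Q(U,U) := |Π̃U|²_{g̃} - (K_β K^α U^β{}_α)² + g̃_{γδ} (B^α U^γ{}_α)(B^β U^δ{}_β) + (g̃^{-1})^{αβ} (B_γ U^γ{}_α)(B_δ U^δ{}_β) + (B_β B^α U^β{}_α)², where (Π̃U)^δ{}_γ := Π̃^δ_β Π̃^α_γ U^β{}_α and |T|²_{g̃} := g̃_{δκ}(g̃^{-1})^{γλ} T^δ{}_γ T^κ{}_λ. Then Q is positive definite on the space of real 4×4 arrays: Q(U,U) ≥ 0 for every U, and Q(U,U) = 0 implies U = 0. -/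
noncomputable section

open scoped BigOperators

namespace Acoustical

open Matrix

section Abstract

theorem eq_zero_of_add_four_nonpos {p q r s : ℝ} (hp : 0 ≤ p) (hq : 0 ≤ q) (hr : 0 ≤ r)
    (hs : 0 ≤ s) (h : p + q + r + s ≤ 0) : p = 0 ∧ q = 0 ∧ r = 0 ∧ s = 0 := by
  refine ⟨?_, ?_, ?_, ?_⟩ <;> linarith

variable {n : Type*} [Fintype n]

theorem sum_sum_mul_mul (A : Matrix n n ℝ) (x y : n → ℝ) :
    ∑ i, ∑ j, A i j * x i * y j = x ⬝ᵥ A *ᵥ y := by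
  simp only [dotProduct, mulVec, Finset.mul_sum]
  exact Finset.sum_congr rfl fun i _ ↦ Finset.sum_congr rfl fun j _ ↦ by ring

theorem dotProduct_transpose_mul_self_mulVec (F : Matrix n n ℝ) (x y : n → ℝ) :
    x ⬝ᵥ (Fᵀ * F) *ᵥ y = (F *ᵥ x) ⬝ᵥ (F *ᵥ y) := by
  rw [← mulVec_mulVec, dotProduct_mulVec, vecMul_transpose]

theorem sum_lower_mul_mul (M : Matrix n n ℝ) (x y : n → ℝ) :
    ∑ β, ∑ α, x β * y α * M β α = x ⬝ᵥ M *ᵥ y := by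
  rw [← sum_sum_mul_mul]
  exact Finset.sum_congr rfl fun i _ ↦ Finset.sum_congr rfl fun j _ ↦ by ring

theorem dotProduct_self_nonneg (x : n → ℝ) : 0 ≤ x ⬝ᵥ x :=
  Finset.sum_nonneg fun i _ ↦ mul_self_nonneg (x i)

theorem sum_mul_mul_eq_sum_sq (F E T : Matrix n n ℝ) :
    ∑ δ, ∑ κ, ∑ γ, ∑ μ, (Fᵀ * F) δ κ * (E * Eᵀ) γ μ * T δ γ * T κ μ =
      ∑ i, ∑ j, (F * T * E) i j ^ 2 := by
  have h₁ : ∑ δ, ∑ κ, ∑ γ, ∑ μ, (Fᵀ * F) δ κ * (E * Eᵀ) γ μ * T δ γ * T κ μ =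
      trace ((Fᵀ * F) * (T * (E * Eᵀ) * Tᵀ)) := by
    simp only [trace, diag_apply]
    refine Finset.sum_congr rfl fun δ _ ↦ ?_
    rw [mul_apply]
    refine Finset.sum_congr rfl fun κ _ ↦ ?_
    rw [mul_apply (M := T * (E * Eᵀ)), Finset.mul_sum]
    refine Finset.sum_congr rfl fun γ _ ↦ ?_
    rw [mul_apply (M := T), Finset.sum_mul, Finset.mul_sum]
    refine Finset.sum_congr rfl fun μ _ ↦ ?_
    have : (E * Eᵀ) γ μ = (E * Eᵀ) μ γ := by
      simp only [mul_apply, transpose_apply, mul_comm]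
    rw [transpose_apply, this]
    ring
  have h₂ : trace ((Fᵀ * F) * (T * (E * Eᵀ) * Tᵀ)) = trace ((F * T * E) * (F * T * E)ᵀ) := by
    rw [transpose_mul, transpose_mul, Matrix.mul_assoc Fᵀ, trace_mul_comm Fᵀ]
    simp only [Matrix.mul_assoc]
  rw [h₁, h₂]
  simp only [trace, diag_apply, mul_apply (M := F * T * E), transpose_apply, sq]

/-- The Cauchy-Schwarz inequality for the Hilbert-Schmidt norm, tested on a rank one matrix. -/
theorem sq_dotProduct_mulVec_le (A : Matrix n n ℝ) (k : n → ℝ) :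
    (k ⬝ᵥ A *ᵥ k) ^ 2 ≤ (k ⬝ᵥ k) ^ 2 * ∑ i, ∑ j, A i j ^ 2 := by
  have h := Finset.sum_mul_sq_le_sq_mul_sq (Finset.univ : Finset (n × n))
    (fun p ↦ k p.1 * k p.2) (fun p ↦ A p.1 p.2)
  simp only [Fintype.sum_prod_type] at h
  have h₁ : ∑ i, ∑ j, k i * k j * A i j = k ⬝ᵥ A *ᵥ k := by
    rw [← sum_sum_mul_mul]
    exact Finset.sum_congr rfl fun i _ ↦ Finset.sum_congr rfl fun j _ ↦ by ring
  have h₂ : ∑ i, ∑ j, (k i * k j) ^ 2 = (k ⬝ᵥ k) ^ 2 := by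
    simp only [sq, dotProduct, Finset.sum_mul_sum]
    exact Finset.sum_congr rfl fun i _ ↦ Finset.sum_congr rfl fun j _ ↦ by ring
  rwa [h₁, h₂] at h

open scoped MatrixOrder in
theorem exists_transpose_mul_self_eq [DecidableEq n] {A : Matrix n n ℝ} (hA : A.PosSemidef) :
    ∃ F : Matrix n n ℝ, Fᵀ * F = A := by
  obtain ⟨F, hF⟩ := CStarAlgebra.nonneg_iff_eq_star_mul_self.mp hA.nonneg
  exact ⟨F, by rw [hF, star_eq_conjTranspose, conjTranspose_eq_transpose_of_trivial]⟩

variable {G H F : Matrix n n ℝ} {a B : n → ℝ} {ν : ℝ}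

theorem vecMul_of_symm (hG : Gᵀ = G) (x : n → ℝ) : x ᵥ* G = G *ᵥ x := by
  rw [← mulVec_transpose, hG]

/-- The quadratic form written through a square root `F` of the first fundamental form. -/
def factoredForm (G H F : Matrix n n ℝ) (B k : n → ℝ) (M : Matrix n n ℝ) : ℝ :=
  ∑ i, ∑ j, (F * M * (H * Fᵀ)) i j ^ 2 - (k ⬝ᵥ (F * M * (H * Fᵀ)) *ᵥ k) ^ 2 +
    (F *ᵥ M *ᵥ B) ⬝ᵥ (F *ᵥ M *ᵥ B) +
    ((G *ᵥ B) ᵥ* M ᵥ* (H * Fᵀ)) ⬝ᵥ ((G *ᵥ B) ᵥ* M ᵥ* (H * Fᵀ)) +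
    ((G *ᵥ B) ⬝ᵥ M *ᵥ B) ^ 2

theorem factoredForm_ge (k : n → ℝ) (M : Matrix n n ℝ) :
    (1 - (k ⬝ᵥ k) ^ 2) * ∑ i, ∑ j, (F * M * (H * Fᵀ)) i j ^ 2 +
    (F *ᵥ M *ᵥ B) ⬝ᵥ (F *ᵥ M *ᵥ B) +
    ((G *ᵥ B) ᵥ* M ᵥ* (H * Fᵀ)) ⬝ᵥ ((G *ᵥ B) ᵥ* M ᵥ* (H * Fᵀ)) +
    ((G *ᵥ B) ⬝ᵥ M *ᵥ B) ^ 2 ≤ factoredForm G H F B k M := by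
  have := sq_dotProduct_mulVec_le (F * M * (H * Fᵀ)) k
  unfold factoredForm
  linarith

theorem factoredForm_nonneg {k : n → ℝ} (hk : k ⬝ᵥ k < 1) (M : Matrix n n ℝ) :
    0 ≤ factoredForm G H F B k M := by
  refine le_trans ?_ (factoredForm_ge k M)
  have h₀ : 0 ≤ k ⬝ᵥ k := dotProduct_self_nonneg k
  have h₁ : 0 ≤ 1 - (k ⬝ᵥ k) ^ 2 := by nlinarith
  have h₂ := dotProduct_self_nonneg (F *ᵥ M *ᵥ B)
  have h₃ := dotProduct_self_nonneg ((G *ᵥ B) ᵥ* M ᵥ* (H * Fᵀ))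
  positivity

theorem factor_mulVec_normal (hF : Fᵀ * F = G + vecMulVec (G *ᵥ a) (G *ᵥ a))
    (haa : a ⬝ᵥ G *ᵥ a = -1) : F *ᵥ a = 0 := by
  have h := dotProduct_transpose_mul_self_mulVec F a a
  rw [hF, add_mulVec, dotProduct_add, vecMulVec_mulVec, dotProduct_comm (G *ᵥ a), haa] at h
  simpa [haa, eq_comm] using h

variable [DecidableEq n]

theorem factor_mul_projection (hF : Fᵀ * F = G + vecMulVec (G *ᵥ a) (G *ᵥ a))
    (haa : a ⬝ᵥ G *ᵥ a = -1) : F * (1 + vecMulVec a (G *ᵥ a)) = F := by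
  rw [Matrix.mul_add, mul_vecMulVec, factor_mulVec_normal hF haa]
  simp

theorem symm_inv (hG : Gᵀ = G) (hHG : H * G = 1) : Hᵀ = H := by
  have h : G * Hᵀ = 1 := by rw [← hG, ← transpose_mul, hHG, transpose_one]
  calc Hᵀ = H * G * Hᵀ := by rw [hHG, Matrix.one_mul]
    _ = H := by rw [Matrix.mul_assoc, h, Matrix.mul_one]

/-- If `F` is a square root of the first fundamental form, then `H * Fᵀ` is one of its inverse. -/
theorem inverse_factor (hG : Gᵀ = G) (hHG : H * G = 1)
    (hF : Fᵀ * F = G + vecMulVec (G *ᵥ a) (G *ᵥ a)) :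
    (H * Fᵀ) * (H * Fᵀ)ᵀ = H + vecMulVec a a := by
  have hH := symm_inv hG hHG
  have hGH : G * H = 1 := mul_eq_one_comm.mp hHG
  have h : (H * Fᵀ) * (H * Fᵀ)ᵀ = H * (Fᵀ * F) * H := by
    rw [transpose_mul, transpose_transpose, hH]
    simp only [Matrix.mul_assoc]
  rw [h, hF, Matrix.mul_add, hHG, Matrix.add_mul, Matrix.one_mul, mul_vecMulVec, vecMulVec_mul,
    vecMul_of_symm hH, mulVec_mulVec, hHG, one_mulVec]

theorem projection_mul_inverse_factor (hG : Gᵀ = G) (hHG : H * G = 1)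
    (hF : Fᵀ * F = G + vecMulVec (G *ᵥ a) (G *ᵥ a)) (haa : a ⬝ᵥ G *ᵥ a = -1) :
    (1 + vecMulVec a (G *ᵥ a)) * (H * Fᵀ) = H * Fᵀ := by
  have hH := symm_inv hG hHG
  rw [Matrix.add_mul, Matrix.one_mul, vecMulVec_mul, ← vecMul_vecMul, vecMul_of_symm hH,
    mulVec_mulVec, hHG, one_mulVec, vecMul_transpose, factor_mulVec_normal hF haa]
  simp

theorem eq_zero_of_factor_mulVec (hHG : H * G = 1)
    (hF : Fᵀ * F = G + vecMulVec (G *ᵥ a) (G *ᵥ a)) (haB : ν * (a ⬝ᵥ G *ᵥ B) = -1)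
    {x : n → ℝ} (hx : F *ᵥ x = 0) (hBx : (G *ᵥ B) ⬝ᵥ x = 0) : x = 0 := by
  have h₁ : (Fᵀ * F) *ᵥ x = 0 := by rw [← mulVec_mulVec, hx, mulVec_zero]
  rw [hF, add_mulVec, vecMulVec_mulVec] at h₁
  set s := (G *ᵥ a) ⬝ᵥ x with hs
  have h₂ : x + s • a = 0 := by
    have := congrArg (H *ᵥ ·) h₁
    simpa [mulVec_add, mulVec_smul, hHG] using this
  have hs0 : s = 0 := by
    have := congrArg ((G *ᵥ B) ⬝ᵥ ·) h₂
    simp only [dotProduct_add, dotProduct_smul, hBx, dotProduct_zero, smul_eq_mul, zero_add,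
      dotProduct_comm _ a] at this
    linear_combination s * haB - ν * this
  simpa [hs0] using h₂

theorem eq_zero_of_factoredForm_eq_zero (hG : Gᵀ = G) (hHG : H * G = 1)
    (hF : Fᵀ * F = G + vecMulVec (G *ᵥ a) (G *ᵥ a)) (haB : ν * (a ⬝ᵥ G *ᵥ B) = -1)
    {k : n → ℝ} (hk : k ⬝ᵥ k < 1) {M : Matrix n n ℝ} (hM : factoredForm G H F B k M = 0) :
    M = 0 := by
  have hH := symm_inv hG hHG
  have hGH : G * H = 1 := mul_eq_one_comm.mp hHG
  have hge := factoredForm_ge (G := G) (H := H) (F := F) (B := B) k M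
  rw [hM] at hge
  have h₀ : 0 ≤ k ⬝ᵥ k := dotProduct_self_nonneg k
  have h₁ : 0 < 1 - (k ⬝ᵥ k) ^ 2 := by nlinarith
  have h₂ := dotProduct_self_nonneg (F *ᵥ M *ᵥ B)
  have h₃ := dotProduct_self_nonneg ((G *ᵥ B) ᵥ* M ᵥ* (H * Fᵀ))
  have h₄ := sq_nonneg ((G *ᵥ B) ⬝ᵥ M *ᵥ B)
  have h₅ : 0 ≤ ∑ i, ∑ j, (F * M * (H * Fᵀ)) i j ^ 2 :=
    Finset.sum_nonneg fun i _ ↦ Finset.sum_nonneg fun j _ ↦ sq_nonneg _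
  have h₆ := mul_nonneg h₁.le h₅
  obtain ⟨z₁, z₂, z₃, z₄⟩ := eq_zero_of_add_four_nonpos h₆ h₂ h₃ h₄ hge
  have e₁ : F *ᵥ M *ᵥ B = 0 := dotProduct_self_eq_zero.mp z₂
  have e₂ : (G *ᵥ B) ᵥ* M ᵥ* (H * Fᵀ) = 0 := dotProduct_self_eq_zero.mp z₃
  have e₃ : (G *ᵥ B) ⬝ᵥ M *ᵥ B = 0 := (pow_eq_zero_iff two_ne_zero).mp z₄
  have e₄ : F * M * (H * Fᵀ) = 0 := by
    have := (mul_eq_zero.mp z₁).resolve_left h₁.ne'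
    ext i j
    have hi := (Fintype.sum_eq_zero_iff_of_nonneg
      fun i ↦ Finset.sum_nonneg fun j _ ↦ sq_nonneg ((F * M * (H * Fᵀ)) i j)).mp this
    have hj := (Fintype.sum_eq_zero_iff_of_nonneg
      fun j ↦ sq_nonneg ((F * M * (H * Fᵀ)) i j)).mp (congrFun hi i)
    simpa using congrFun hj j
  have hMB : M *ᵥ B = 0 := eq_zero_of_factor_mulVec hHG hF haB e₁ e₃
  have hME : M * (H * Fᵀ) = 0 := by
    refine ext_of_mulVec_single fun j ↦ ?_
    rw [zero_mulVec]
    refine eq_zero_of_factor_mulVec hHG hF haB ?_ ?_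
    · rw [mulVec_mulVec, ← Matrix.mul_assoc, e₄, zero_mulVec]
    · rw [dotProduct_mulVec, ← vecMul_vecMul, e₂, zero_dotProduct]
  have hHM : H * Mᵀ = 0 := by
    refine ext_of_mulVec_single fun j ↦ ?_
    rw [zero_mulVec]
    refine eq_zero_of_factor_mulVec hHG hF haB ?_ ?_
    · have := congrArg transpose hME
      rw [transpose_mul, transpose_mul, transpose_transpose, hH, transpose_zero] at this
      rw [mulVec_mulVec, ← Matrix.mul_assoc, this, zero_mulVec]
    · rw [dotProduct_mulVec, ← vecMul_vecMul, vecMul_of_symm hH, mulVec_mulVec, hHG, one_mulVec,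
        vecMul_transpose, hMB, zero_dotProduct]
  have : Mᵀ = 0 := by rw [← Matrix.one_mul Mᵀ, ← hGH, Matrix.mul_assoc, hHM, Matrix.mul_zero]
  simpa using this

/-- The contraction of an array with a vector tangent to the hypersurface. -/
theorem lower_dotProduct_mulVec_of_tangent (hG : Gᵀ = G) (hHG : H * G = 1)
    (hF : Fᵀ * F = G + vecMulVec (G *ᵥ a) (G *ᵥ a)) {K : n → ℝ} (hK : a ⬝ᵥ G *ᵥ K = 0)
    (M : Matrix n n ℝ) :
    (G *ᵥ K) ⬝ᵥ M *ᵥ K = (F *ᵥ K) ⬝ᵥ (F * M * (H * Fᵀ)) *ᵥ (F *ᵥ K) := by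
  have hK' : (G *ᵥ a) ⬝ᵥ K = 0 := by
    rw [← hK, dotProduct_mulVec, vecMul_of_symm hG]
  have h₁ : Fᵀ *ᵥ (F *ᵥ K) = G *ᵥ K := by
    rw [mulVec_mulVec, hF, add_mulVec, vecMulVec_mulVec, hK']
    simp
  have h₂ : (H * Fᵀ) *ᵥ (F *ᵥ K) = K := by
    rw [← mulVec_mulVec, h₁, mulVec_mulVec, hHG, one_mulVec]
  rw [← mulVec_mulVec (M := F * M), h₂, ← mulVec_mulVec, dotProduct_mulVec (F *ᵥ K),
    ← mulVec_transpose, h₁]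

end Abstract

section Concrete

/-- The acoustical metric as a matrix. -/
def metric (c : ℝ) (v : Fin 4 → ℝ) : Matrix (Fin 4) (Fin 4) ℝ := of (gmet c v)

/-- The inverse acoustical metric as a matrix. -/
def inverseMetric (c : ℝ) (v : Fin 4 → ℝ) : Matrix (Fin 4) (Fin 4) ℝ := of (ginv c v)

variable {c : ℝ} {v N : Fin 4 → ℝ}

theorem metric_transpose : (metric c v)ᵀ = metric c v := by
  ext i j
  fin_cases i <;> fin_cases j <;> simp [metric, gmet]

theorem inverseMetric_mul_metric (hc : 0 < c) :
    inverseMetric c v * metric c v = 1 := by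
  ext i j
  fin_cases i <;> fin_cases j <;>
    simp [metric, inverseMetric, gmet, ginv, spIdx, mul_apply, Fin.sum_univ_four] <;>
    field_simp <;> ring

theorem gip_eq (X Y : Fin 4 → ℝ) : gip c v X Y = X ⬝ᵥ metric c v *ᵥ Y :=
  sum_sum_mul_mul (metric c v) X Y

theorem glow_eq (X : Fin 4 → ℝ) : glow c v X = metric c v *ᵥ X := rfl

theorem gip_comm (X Y : Fin 4 → ℝ) : gip c v X Y = gip c v Y X := by
  rw [gip_eq, gip_eq, dotProduct_mulVec, vecMul_of_symm metric_transpose, dotProduct_comm]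

theorem gip_explicit (hc : 0 < c) (X Y : Fin 4 → ℝ) :
    gip c v X Y = -(X 0 * Y 0) + ((X 1 - v 1 * X 0) / c) * ((Y 1 - v 1 * Y 0) / c) +
      ((X 2 - v 2 * X 0) / c) * ((Y 2 - v 2 * Y 0) / c) +
      ((X 3 - v 3 * X 0) / c) * ((Y 3 - v 3 * Y 0) / c) := by
  simp [gip, gmet, spIdx, Fin.sum_univ_four]
  field_simp
  ring

theorem gip_Bvec (hc : 0 < c) (hv0 : v 0 = 0) (X : Fin 4 → ℝ) : gip c v X (Bvec v) = -X 0 := by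
  rw [gip_explicit hc]
  simp [Bvec, hv0]

/-- A reversed Cauchy-Schwarz inequality in Minkowski space. -/
theorem reversed_cauchy_schwarz {n₁ n₂ n₃ s y₁ y₂ y₃ : ℝ} (hn : n₁ ^ 2 + n₂ ^ 2 + n₃ ^ 2 < 1) :
    0 ≤ (1 - (n₁ ^ 2 + n₂ ^ 2 + n₃ ^ 2)) * (-(s * s) + y₁ * y₁ + y₂ * y₂ + y₃ * y₃) +
      (-s + n₁ * y₁ + n₂ * y₂ + n₃ * y₃) ^ 2 := by
  set r := n₁ ^ 2 + n₂ ^ 2 + n₃ ^ 2 with hr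
  have hr0 : 0 ≤ r := by positivity
  rcases hr0.eq_or_lt with h | h
  · have h₁ : n₁ = 0 := by nlinarith [sq_nonneg n₁, sq_nonneg n₂, sq_nonneg n₃]
    have h₂ : n₂ = 0 := by nlinarith [sq_nonneg n₁, sq_nonneg n₂, sq_nonneg n₃]
    have h₃ : n₃ = 0 := by nlinarith [sq_nonneg n₁, sq_nonneg n₂, sq_nonneg n₃]
    rw [← h, h₁, h₂, h₃]
    nlinarith [mul_self_nonneg y₁, mul_self_nonneg y₂, mul_self_nonneg y₃]
  · refine nonneg_of_mul_nonneg_right (a := r) ?_ h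
    have hcs : 0 ≤ (1 - r) * ((n₁ * y₂ - n₂ * y₁) ^ 2 + (n₁ * y₃ - n₃ * y₁) ^ 2 +
        (n₂ * y₃ - n₃ * y₂) ^ 2) := mul_nonneg (by linarith) (by positivity)
    have hsq := sq_nonneg (r * s - (n₁ * y₁ + n₂ * y₂ + n₃ * y₃))
    refine (add_nonneg hcs hsq).trans_eq ?_
    rw [hr]
    ring

theorem gip_add_sq_nonneg (hc : 0 < c) (hN : N 0 = 1) (hNN : gip c v N N < 0)
    (X : Fin 4 → ℝ) : 0 ≤ (-gip c v N N) * gip c v X X + gip c v N X ^ 2 := by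
  rw [gip_explicit hc N N, hN] at hNN ⊢
  rw [gip_explicit hc X X, gip_explicit hc N X, hN]
  refine (reversed_cauchy_schwarz (n₁ := (N 1 - v 1 * 1) / c) (n₂ := (N 2 - v 2 * 1) / c)
    (n₃ := (N 3 - v 3 * 1) / c) (s := X 0) (y₁ := (X 1 - v 1 * X 0) / c)
    (y₂ := (X 2 - v 2 * X 0) / c) (y₃ := (X 3 - v 3 * X 0) / c) (by linarith)).trans_eq ?_
  ring

theorem nuP_pos (hNN : gip c v N N < 0) : 0 < nuP c v N :=
  Real.sqrt_pos.mpr (by linarith)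

theorem nuP_sq (hNN : gip c v N N < 0) : nuP c v N ^ 2 = -gip c v N N :=
  Real.sq_sqrt (by linarith)

theorem nhat_eq : nhat c v N = (nuP c v N)⁻¹ • N := by
  ext i
  simp [nhat, div_eq_inv_mul]

theorem Kvec_eq : Kvec c v N = nuP c v N • Bvec v - nhat c v N := rfl

theorem nuP_mul_gip_nhat (hNN : gip c v N N < 0) (X : Fin 4 → ℝ) :
    nuP c v N * (nhat c v N ⬝ᵥ metric c v *ᵥ X) = gip c v N X := by
  have := (nuP_pos hNN).ne'
  rw [nhat_eq, smul_dotProduct, gip_eq, smul_eq_mul]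
  field_simp

theorem gip_nhat_self (hNN : gip c v N N < 0) :
    nhat c v N ⬝ᵥ metric c v *ᵥ nhat c v N = -1 := by
  have h := (nuP_pos hNN).ne'
  have h₁ := nuP_mul_gip_nhat hNN (nhat c v N)
  have h₂ := nuP_mul_gip_nhat hNN N
  rw [gip_comm, gip_eq] at h₁
  have h₃ := nuP_sq hNN
  refine mul_left_cancel₀ (pow_ne_zero 2 h) ?_
  linear_combination nuP c v N * h₁ + h₂ + h₃

theorem metric_mulVec_nhat_dotProduct (X : Fin 4 → ℝ) :
    (metric c v *ᵥ nhat c v N) ⬝ᵥ X = nhat c v N ⬝ᵥ metric c v *ᵥ X := by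
  rw [dotProduct_mulVec, vecMul_of_symm metric_transpose]

theorem posSemidef_firstFundamentalForm (hc : 0 < c) (hN : N 0 = 1) (hNN : gip c v N N < 0) :
    (metric c v +
      vecMulVec (metric c v *ᵥ nhat c v N) (metric c v *ᵥ nhat c v N)).PosSemidef := by
  refine .of_dotProduct_mulVec_nonneg ?_ fun X ↦ ?_
  · rw [IsHermitian, conjTranspose_eq_transpose_of_trivial, transpose_add, metric_transpose,
      transpose_vecMulVec]
  · have h := gip_add_sq_nonneg hc hN hNN X
    have hν := nuP_pos hNN
    rw [← nuP_sq hNN, ← nuP_mul_gip_nhat hNN X, mul_pow, ← mul_add] at h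
    have h' := nonneg_of_mul_nonneg_right h (by positivity)
    rw [star_trivial, add_mulVec, dotProduct_add, vecMulVec_mulVec, op_smul_eq_smul,
      dotProduct_smul, dotProduct_comm X (_ *ᵥ nhat c v N), metric_mulVec_nhat_dotProduct,
      smul_eq_mul, ← sq, ← gip_eq]
    exact h'

theorem projMat_eq (M : Matrix (Fin 4) (Fin 4) ℝ) :
    projMat c v N M = ((1 + vecMulVec (nhat c v N) (metric c v *ᵥ nhat c v N)) * M *
      (1 + vecMulVec (nhat c v N) (metric c v *ᵥ nhat c v N)) : Matrix (Fin 4) (Fin 4) ℝ) := by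
  have hp : 1 + vecMulVec (nhat c v N) (metric c v *ᵥ nhat c v N) = of (projT c v N) := by
    ext i j
    simp [projT, glow_eq, one_apply, vecMulVec_apply]
  ext i j
  rw [hp]
  simp only [projMat, mul_apply, of_apply, Finset.sum_mul]
  rw [Finset.sum_comm]
  exact Finset.sum_congr rfl fun _ _ ↦ Finset.sum_congr rfl fun _ _ ↦ by ring

theorem Qform_eq (hc : 0 < c) (hNB : gip c v N (Bvec v) = -1)
    (hNN : gip c v N N < 0) {F : Matrix (Fin 4) (Fin 4) ℝ}
    (hF : Fᵀ * F = metric c v +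
      vecMulVec (metric c v *ᵥ nhat c v N) (metric c v *ᵥ nhat c v N))
    (M : Matrix (Fin 4) (Fin 4) ℝ) :
    Qform c v N M = factoredForm (metric c v) (inverseMetric c v) F (Bvec v)
      (F *ᵥ Kvec c v N) M := by
  have hG := metric_transpose (c := c) (v := v)
  have hHG := inverseMetric_mul_metric (v := v) hc
  have haa := gip_nhat_self hNN
  have haB := nuP_mul_gip_nhat hNN (Bvec v)
  rw [hNB] at haB
  have hE := inverse_factor hG hHG hF
  have hgt : gtmet c v N = Fᵀ * F := by rw [hF]; rfl
  have hgi : gtinv c v N = (inverseMetric c v * Fᵀ) * (inverseMetric c v * Fᵀ)ᵀ := by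
    rw [hE]; rfl
  have hK : nhat c v N ⬝ᵥ metric c v *ᵥ Kvec c v N = 0 := by
    rw [Kvec_eq, mulVec_sub, dotProduct_sub, mulVec_smul, dotProduct_smul, smul_eq_mul, haB, haa,
      sub_self]
  have t₁ : gtNormSq c v N (projMat c v N M) =
      ∑ i, ∑ j, (F * M * (inverseMetric c v * Fᵀ)) i j ^ 2 := by
    rw [gtNormSq, hgt, hgi, projMat_eq, sum_mul_mul_eq_sum_sq]
    have h : ∀ P E : Matrix (Fin 4) (Fin 4) ℝ, F * (P * M * P) * E = F * P * M * (P * E) :=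
      fun P E ↦ by simp only [Matrix.mul_assoc]
    rw [h, factor_mul_projection hF haa, projection_mul_inverse_factor hG hHG hF haa]
  have t₃ : ∑ γ, ∑ δ, gtmet c v N γ δ * (∑ α, Bvec v α * M γ α) * (∑ β, Bvec v β * M δ β) =
      (F *ᵥ M *ᵥ Bvec v) ⬝ᵥ (F *ᵥ M *ᵥ Bvec v) := by
    rw [← dotProduct_transpose_mul_self_mulVec, ← sum_sum_mul_mul, hgt]
    simp only [mulVec, dotProduct, mul_comm]
  have t₄ : ∑ α, ∑ β, gtinv c v N α β * (∑ γ, glow c v (Bvec v) γ * M γ α) *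
      (∑ δ, glow c v (Bvec v) δ * M δ β) =
      ((metric c v *ᵥ Bvec v) ᵥ* M ᵥ* (inverseMetric c v * Fᵀ)) ⬝ᵥ
        ((metric c v *ᵥ Bvec v) ᵥ* M ᵥ* (inverseMetric c v * Fᵀ)) := by
    set E := inverseMetric c v * Fᵀ
    rw [← mulVec_transpose E, ← dotProduct_transpose_mul_self_mulVec, ← sum_sum_mul_mul, hgi,
      transpose_transpose]
    rfl
  rw [Qform, t₁, t₃, t₄, factoredForm, glow_eq, glow_eq, sum_lower_mul_mul, sum_lower_mul_mul,
    lower_dotProduct_mulVec_of_tangent hG hHG hF hK]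

theorem factor_Kvec_lt_one (hNB : gip c v N (Bvec v) = -1)
    (hBB : gip c v (Bvec v) (Bvec v) = -1) (hNN : gip c v N N < 0)
    {F : Matrix (Fin 4) (Fin 4) ℝ}
    (hF : Fᵀ * F = metric c v +
      vecMulVec (metric c v *ᵥ nhat c v N) (metric c v *ᵥ nhat c v N)) :
    (F *ᵥ Kvec c v N) ⬝ᵥ (F *ᵥ Kvec c v N) < 1 := by
  have haa := gip_nhat_self hNN
  have haB := nuP_mul_gip_nhat hNN (Bvec v)
  rw [hNB] at haB
  have hν := nuP_pos hNN
  rw [gip_eq] at hBB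
  rw [Kvec_eq, mulVec_sub, factor_mulVec_normal hF haa, sub_zero, mulVec_smul, smul_dotProduct,
    dotProduct_smul, ← dotProduct_transpose_mul_self_mulVec, hF, add_mulVec, dotProduct_add,
    vecMulVec_mulVec, op_smul_eq_smul, dotProduct_smul,
    dotProduct_comm (Bvec v) (_ *ᵥ nhat c v N), metric_mulVec_nhat_dotProduct, hBB]
  simp only [smul_eq_mul]
  nlinarith [sq_nonneg (nuP c v N), mul_pos hν hν, haB]

end Concrete

end Acoustical

/-- The quadratic form `Q` is positive definite on the space
of real `4×4` arrays. -/
theorem stmt8_Qform_positive_definite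
    (c : ℝ) (v N : Fin 4 → ℝ) (hc : 0 < c) (hv0 : v 0 = 0)
    (hNB : gip c v N (Bvec v) = -1) (hNN : gip c v N N < 0) :
    (∀ M : Matrix (Fin 4) (Fin 4) ℝ, 0 ≤ Qform c v N M) ∧
    ∀ M : Matrix (Fin 4) (Fin 4) ℝ, Qform c v N M = 0 → M = 0 := by
  have hN : N 0 = 1 := by
    rw [Acoustical.gip_Bvec hc hv0] at hNB
    linarith
  have hBB : gip c v (Bvec v) (Bvec v) = -1 := by
    rw [Acoustical.gip_Bvec hc hv0]
    simp [Bvec, hv0]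
  obtain ⟨F, hF⟩ := Acoustical.exists_transpose_mul_self_eq
    (Acoustical.posSemidef_firstFundamentalForm hc hN hNN)
  have hk := Acoustical.factor_Kvec_lt_one hNB hBB hNN hF
  have haB := Acoustical.nuP_mul_gip_nhat hNN (Bvec v)
  rw [hNB] at haB
  refine ⟨fun M ↦ ?_, fun M hM ↦ ?_⟩
  · rw [Acoustical.Qform_eq hc hNB hNN hF]
    exact Acoustical.factoredForm_nonneg hk M
  · rw [Acoustical.Qform_eq hc hNB hNN hF] at hM
    exact Acoustical.eq_zero_of_factoredForm_eq_zero Acoustical.metric_transpose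
      (Acoustical.inverseMetric_mul_metric hc) hF haB hk hM
end
end

section
/- Let V be a smooth Σ_t-tangent vectorfield on U (V^0 ≡ 0) and set V_α := g_{αβ} V^β. Then for all α, β ∈ {0,1,2,3}, at every point of U: ∂_α V_β - ∂_β V_α = 2(∂_β ln c) V_α - 2(∂_α ln c) V_β + δ_α^0 V_a ∂_β v^a - δ_β^0 V_a ∂_α v^a + (δ_α^0 g_{βγ} - δ_β^0 g_{αγ}) (B^μ ∂_μ V^γ) + c^{-2} ε_{αβγδ} B^γ (curl V)^δ, where (curl V)^0 := 0, (curl V)^i := ε_{iab} ∂_a V^b, ε_{ijk} is the totally antisymmetric symbol with ε_{123} = 1, and ε_{αβγδ} is the totally antisymmetric symbol with ε_{0123} = 1. -/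
noncomputable section

open scoped BigOperators

/-- Lowering a `Σ_t`-tangent vector: the spatial components are rescaled by `c⁻²`. -/
lemma glow_spatial {c : ℝ} {v X : Fin 4 → ℝ} (hX : X 0 = 0) {β : Fin 4} (hβ : β ≠ 0) :
    glow c v X β = X β / c ^ 2 := by
  fin_cases β <;> simp_all [glow, gmet, Fin.sum_univ_four] <;> ring

/-- Lowering a `Σ_t`-tangent vector: the time component is `-c⁻² vₐ Xᵃ`. -/
lemma glow_time {c : ℝ} {v X : Fin 4 → ℝ} (hX : X 0 = 0) :
    glow c v X 0 = -(v 1 * X 1 + v 2 * X 2 + v 3 * X 3) / c ^ 2 := by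
  simp [glow, gmet, Fin.sum_univ_four, hX]
  ring

lemma pd_congr {f g : (Fin 4 → ℝ) → ℝ} {x : Fin 4 → ℝ} (h : f =ᶠ[nhds x] g) (α : Fin 4) :
    pd f α x = pd g α x := by
  rw [pd, pd, h.fderiv_eq]

lemma pd_neg (f : (Fin 4 → ℝ) → ℝ) (α : Fin 4) (x : Fin 4 → ℝ) :
    pd (fun y => -f y) α x = -pd f α x := by
  simp [pd, fderiv_fun_neg]

lemma pd_add {f g : (Fin 4 → ℝ) → ℝ} {x : Fin 4 → ℝ} (hf : DifferentiableAt ℝ f x)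
    (hg : DifferentiableAt ℝ g x) (α : Fin 4) :
    pd (fun y => f y + g y) α x = pd f α x + pd g α x := by
  simp [pd, fderiv_fun_add hf hg]

lemma pd_mul {f g : (Fin 4 → ℝ) → ℝ} {x : Fin 4 → ℝ} (hf : DifferentiableAt ℝ f x)
    (hg : DifferentiableAt ℝ g x) (α : Fin 4) :
    pd (fun y => f y * g y) α x = f x * pd g α x + g x * pd f α x := by
  simp [pd, fderiv_fun_mul hf hg]

lemma pd_div_sq {f c : (Fin 4 → ℝ) → ℝ} {x : Fin 4 → ℝ} (hf : DifferentiableAt ℝ f x)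
    (hc : DifferentiableAt ℝ c x) (hcx : c x ≠ 0) (α : Fin 4) :
    pd (fun y => f y / c y ^ 2) α x
      = pd f α x / c x ^ 2 - 2 * pd (fun y => Real.log (c y)) α x * (f x / c x ^ 2) := by
  have hlog : HasFDerivAt (fun y => Real.log (c y)) _ x := hc.hasFDerivAt.log hcx
  have hdiv : HasFDerivAt (fun y => f y * (c y ^ 2)⁻¹) _ x := hf.hasFDerivAt.fun_mul
    ((hasDerivAt_inv (pow_ne_zero 2 hcx)).comp_hasFDerivAt x (hc.hasFDerivAt.pow 2))
  simp only [pd, div_eq_mul_inv]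
  rw [hdiv.fderiv, hlog.fderiv]
  simp
  field_simp
  ring

/-- For a smooth `Σ_t`-tangent vectorfield `V`, the
antisymmetrized gradient of the `g`-dual one-form of `V` satisfies, for all
`α, β`:
`∂_αV_β - ∂_βV_α = 2(∂_β ln c)V_α - 2(∂_α ln c)V_β + δ_α^0 Vₐ∂_βvᵃ - δ_β^0 Vₐ∂_αvᵃ
 + (δ_α^0 g_{βγ} - δ_β^0 g_{αγ})(B^μ∂_μV^γ) + c⁻²ε_{αβγδ}B^γ(curl V)^δ`. -/
theorem stmt11_antisymmetrized_gradient_of_lowered_tangent_vectorfield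
    (U : Set (Fin 4 → ℝ)) (hUopen : IsOpen U) (hUne : U.Nonempty)
    (v : (Fin 4 → ℝ) → Fin 4 → ℝ) (c : (Fin 4 → ℝ) → ℝ)
    (hv : ContDiffOn ℝ (⊤ : ℕ∞) v U) (hc : ContDiffOn ℝ (⊤ : ℕ∞) c U)
    (hv0 : ∀ x, v x 0 = 0) (hcpos : ∀ x ∈ U, 0 < c x)
    (V : (Fin 4 → ℝ) → Fin 4 → ℝ) (hV : ContDiffOn ℝ (⊤ : ℕ∞) V U)
    (hV0 : ∀ x ∈ U, V x 0 = 0) :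
    ∀ x ∈ U, ∀ α β : Fin 4,
      pd (fun y => glow (c y) (v y) (V y) β) α x
        - pd (fun y => glow (c y) (v y) (V y) α) β x
      = 2 * pd (fun y => Real.log (c y)) β x * glow (c x) (v x) (V x) α
        - 2 * pd (fun y => Real.log (c y)) α x * glow (c x) (v x) (V x) β
        + (if α = 0 then (1 : ℝ) else 0) *
            (∑ a ∈ spIdx, glow (c x) (v x) (V x) a * pd (fun y => v y a) β x)
        - (if β = 0 then (1 : ℝ) else 0) *
            (∑ a ∈ spIdx, glow (c x) (v x) (V x) a * pd (fun y => v y a) α x)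
        + (∑ γ : Fin 4,
            ((if α = 0 then (1 : ℝ) else 0) * gmet (c x) (v x) β γ
              - (if β = 0 then (1 : ℝ) else 0) * gmet (c x) (v x) α γ) *
              ∑ μ : Fin 4, Bvec (v x) μ * pd (fun y => V y γ) μ x)
        + (∑ γ : Fin 4, ∑ δ : Fin 4,
            eps4 α β γ δ * Bvec (v x) γ *
              (if δ = 0 then 0 else
                ∑ a : Fin 4, ∑ b : Fin 4, eps3 δ a b * pd (fun y => V y b) a x))
            / c x ^ 2 := by
  intro x hx α β
  have hU : U ∈ nhds x := hUopen.mem_nhds hx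
  have hcd : DifferentiableAt ℝ c x := (hc.contDiffAt hU).differentiableAt (by simp)
  have hvd : ∀ a, DifferentiableAt ℝ (fun y => v y a) x :=
    differentiableAt_pi.1 ((hv.contDiffAt hU).differentiableAt (by simp))
  have hVd : ∀ a, DifferentiableAt ℝ (fun y => V y a) x :=
    differentiableAt_pi.1 ((hV.contDiffAt hU).differentiableAt (by simp))
  have hcx : c x ≠ 0 := (hcpos x hx).ne'
  have hV0d : ∀ μ, pd (fun y => V y 0) μ x = 0 := fun μ => by
    rw [pd_congr (g := fun _ => 0) (Filter.mem_of_superset hU hV0)]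
    simp [pd]
  have hspatial : ∀ b μ, b ≠ 0 → pd (fun y => glow (c y) (v y) (V y) b) μ x
      = pd (fun y => V y b) μ x / c x ^ 2
        - 2 * pd (fun y => Real.log (c y)) μ x * (V x b / c x ^ 2) := fun b μ hb => by
    rw [← pd_div_sq (hVd b) hcd hcx]
    exact pd_congr (Filter.mem_of_superset hU fun y hy => glow_spatial (hV0 y hy) hb) μ
  have htime : ∀ μ, pd (fun y => glow (c y) (v y) (V y) 0) μ x
      = -(v x 1 * pd (fun y => V y 1) μ x + V x 1 * pd (fun y => v y 1) μ x
          + (v x 2 * pd (fun y => V y 2) μ x + V x 2 * pd (fun y => v y 2) μ x)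
          + (v x 3 * pd (fun y => V y 3) μ x + V x 3 * pd (fun y => v y 3) μ x)) / c x ^ 2
        - 2 * pd (fun y => Real.log (c y)) μ x *
          (-(v x 1 * V x 1 + v x 2 * V x 2 + v x 3 * V x 3) / c x ^ 2) := fun μ => by
    have hprod : ∀ a, DifferentiableAt ℝ (fun y => v y a * V y a) x :=
      fun a => (hvd a).mul (hVd a)
    rw [pd_congr (Filter.mem_of_superset hU fun y hy => glow_time (hV0 y hy)),
      pd_div_sq (((hprod 1).fun_add (hprod 2)).fun_add (hprod 3)).fun_neg hcd hcx, pd_neg,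
      pd_add ((hprod 1).fun_add (hprod 2)) (hprod 3), pd_add (hprod 1) (hprod 2),
      pd_mul (hvd 1) (hVd 1), pd_mul (hvd 2) (hVd 2), pd_mul (hvd 3) (hVd 3)]
  have hlow0 : glow (c x) (v x) (V x) 0 = _ := glow_time (hV0 x hx)
  have hlow : ∀ b, b ≠ 0 → glow (c x) (v x) (V x) b = _ := fun b hb =>
    glow_spatial (hV0 x hx) hb
  fin_cases α <;> fin_cases β <;>
    simp [htime, hspatial, hlow0, hlow, hV0d, hv0, gmet, Bvec, spIdx, eps3, eps4,
      Fin.sum_univ_four] <;>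
    ring
end
end

section
/- For smooth solutions (ρ, v, s) of the compressible Euler equations on U, the exterior derivative of the g-dual of the entropy gradient satisfies, for all α, β ∈ {0,1,2,3} and at every point of U: ∂_α S_β - ∂_β S_α = 2(∂_β ln c) S_α - 2(∂_α ln c) S_β, where S_α := g_{αμ} S^μ. -/
noncomputable section

open scoped BigOperators

/-- For a velocity and entropy differential annihilated by the material vectorfield, lowering the
spatial gradient with `g` yields `c⁻²` times the full spacetime differential. -/
theorem glow_spatial_gradient (c : ℝ) (v w S : Fin 4 → ℝ) (hv0 : v 0 = 0)
    (hB : ∑ μ : Fin 4, Bvec v μ * w μ = 0)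
    (hS : ∀ i : Fin 4, S i = if i = 0 then 0 else w i) (β : Fin 4) :
    glow c v S β = (c ^ 2)⁻¹ * w β := by
  simp only [Bvec, Fin.sum_univ_four, hv0] at hB
  simp at hB
  have hw : w 0 = -(v 1 * w 1 + v 2 * w 2 + v 3 * w 3) := by linarith
  fin_cases β <;> simp [glow, gmet, Fin.sum_univ_four, hS, hw]; ring

/-- The exterior derivative of `c⁻² ds` is `-2 d(ln c) ∧ c⁻² ds`. -/
theorem exterior_derivative_inv_sq_mul_gradient (c s : (Fin 4 → ℝ) → ℝ) (x : Fin 4 → ℝ)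
    (T : (Fin 4 → ℝ) → Fin 4 → ℝ)
    (hc : DifferentiableAt ℝ c x) (hcx : c x ≠ 0) (hs : ContDiffAt ℝ 2 s x)
    (hT : ∀ᶠ y in nhds x, ∀ β, T y β = (c y ^ 2)⁻¹ * pd s β y) (α β : Fin 4) :
    pd (fun y => T y β) α x - pd (fun y => T y α) β x
      = 2 * pd (fun y => Real.log (c y)) β x * T x α
        - 2 * pd (fun y => Real.log (c y)) α x * T x β := by
  have hds : DifferentiableAt ℝ (fderiv ℝ s) x :=
    (hs.fderiv_right (m := 1) (by norm_num)).differentiableAt (by norm_num)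
  have hsymm := hs.isSymmSndFDerivAt (by simp)
  have hlog (γ : Fin 4) : pd (fun y => Real.log (c y)) γ x = (c x)⁻¹ * pd c γ x := by
    simp [pd, fderiv.log hc hcx]
  have hpd (γ δ : Fin 4) : pd (fun y => T y γ) δ x =
      (c x ^ 2)⁻¹ * fderiv ℝ (fderiv ℝ s) x (Pi.single δ 1) (Pi.single γ 1)
        - 2 * (c x)⁻¹ ^ 3 * pd c δ x * pd s γ x := by
    have hev : (fun y => T y γ) =ᶠ[nhds x] fun y => (c y ^ 2)⁻¹ * pd s γ y :=
      hT.mono fun y hy => hy γ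
    have hinv : HasFDerivAt (fun y => (c y ^ 2)⁻¹)
        ((-(2 * (c x)⁻¹ ^ 3)) • fderiv ℝ c x) x := by
      have hd : HasDerivAt (fun r : ℝ => (r ^ 2)⁻¹) (-(2 * (c x)⁻¹ ^ 3)) (c x) := by
        refine ((hasDerivAt_pow 2 (c x)).fun_inv (pow_ne_zero 2 hcx)).congr_deriv ?_
        simp
        field_simp
      exact hd.comp_hasFDerivAt x hc.hasFDerivAt
    have hgrad : HasFDerivAt (fun y => pd s γ y)
        ((fderiv ℝ (fderiv ℝ s) x).flip (Pi.single γ 1)) x := by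
      simpa [pd] using hds.hasFDerivAt.clm_apply (hasFDerivAt_const (Pi.single γ (1 : ℝ)) x)
    unfold pd
    rw [hev.fderiv_eq, (hinv.fun_mul hgrad).fderiv]
    simp [pd]
    ring
  rw [hpd, hpd, hlog, hlog, hT.self_of_nhds, hT.self_of_nhds,
    hsymm (Pi.single α 1) (Pi.single β 1)]
  field_simp
  ring

/-- The partial derivative in the first variable of a smooth function of two variables is
differentiable as a function of both variables. -/
theorem differentiableAt_deriv_fst (p : ℝ → ℝ → ℝ) (q : ℝ × ℝ)
    (hp : ContDiffAt ℝ 2 (fun q : ℝ × ℝ => p q.1 q.2) q) :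
    DifferentiableAt ℝ (fun q : ℝ × ℝ => deriv (fun r => p r q.2) q.1) q := by
  have hd : DifferentiableAt ℝ (fderiv ℝ fun q : ℝ × ℝ => p q.1 q.2) q :=
    (hp.fderiv_right (m := 1) (by norm_num)).differentiableAt (by norm_num)
  have hev : (fun q : ℝ × ℝ => deriv (fun r => p r q.2) q.1) =ᶠ[nhds q]
      fun q => fderiv ℝ (fun q : ℝ × ℝ => p q.1 q.2) q (1, 0) := by
    filter_upwards [hp.eventually (by simp)] with z hz
    have h := (hz.differentiableAt (by norm_num)).hasFDerivAt
    exact (h.comp_hasDerivAt z.1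
      ((hasDerivAt_id z.1).prodMk (hasDerivAt_const z.1 z.2))).deriv
  exact (hd.clm_apply (differentiableAt_const _)).congr_of_eventuallyEq hev

/-- For smooth solutions of the compressible Euler equations,
the exterior derivative of the `g`-dual of the entropy gradient `S` satisfies
`∂_αS_β - ∂_βS_α = 2(∂_β ln c)S_α - 2(∂_α ln c)S_β`. -/
theorem stmt13_exterior_derivative_of_dual_entropy_gradient
    (U : Set (Fin 4 → ℝ)) (hUopen : IsOpen U) (hUne : U.Nonempty)
    (ρ s : (Fin 4 → ℝ) → ℝ) (v : (Fin 4 → ℝ) → Fin 4 → ℝ)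
    (hρ : ContDiffOn ℝ (⊤ : ℕ∞) ρ U) (hs : ContDiffOn ℝ (⊤ : ℕ∞) s U)
    (hv : ContDiffOn ℝ (⊤ : ℕ∞) v U) (hv0 : ∀ x, v x 0 = 0)
    (p : ℝ → ℝ → ℝ) (rhob : ℝ) (hrhob : 0 < rhob)
    (hp : ContDiffOn ℝ (⊤ : ℕ∞) (fun q : ℝ × ℝ => p q.1 q.2)
      (Set.Ioi (0 : ℝ) ×ˢ (Set.univ : Set ℝ)))
    (hpmono : ∀ r ∈ Set.Ioi (0 : ℝ), ∀ t : ℝ, 0 < deriv (fun r' => p r' t) r)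
    (c ps : (Fin 4 → ℝ) → ℝ)
    (hcdef : ∀ x, c x = Real.sqrt (deriv (fun r' => p r' (s x)) (rhob * Real.exp (ρ x))))
    (hpsdef : ∀ x, ps x = deriv (fun t => p (rhob * Real.exp (ρ x)) t) (s x))
    (heulρ : ∀ x ∈ U,
      (∑ μ : Fin 4, Bvec (v x) μ * pd ρ μ x) = -∑ a ∈ spIdx, pd (fun y => v y a) a x)
    (heulv : ∀ x ∈ U, ∀ i : Fin 4, i ≠ 0 →
      (∑ μ : Fin 4, Bvec (v x) μ * pd (fun y => v y i) μ x)
        = -(c x ^ 2) * pd ρ i x - Real.exp (-(ρ x)) * (ps x / rhob) * pd s i x)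
    (heuls : ∀ x ∈ U, (∑ μ : Fin 4, Bvec (v x) μ * pd s μ x) = 0)
    (S : (Fin 4 → ℝ) → Fin 4 → ℝ)
    (hS : ∀ x, ∀ i : Fin 4, S x i = if i = 0 then 0 else pd s i x) :
    ∀ x ∈ U, ∀ α β : Fin 4,
      pd (fun y => glow (c y) (v y) (S y) β) α x
        - pd (fun y => glow (c y) (v y) (S y) α) β x
      = 2 * pd (fun y => Real.log (c y)) β x * glow (c x) (v x) (S x) α
        - 2 * pd (fun y => Real.log (c y)) α x * glow (c x) (v x) (S x) β := by
  intro x hx α β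
  have hU := hUopen.mem_nhds hx
  have htwo : (2 : WithTop ℕ∞) ≤ ((⊤ : ℕ∞) : WithTop ℕ∞) := WithTop.coe_le_coe.2 le_top
  have hsx := hs.contDiffAt hU
  have hr : 0 < rhob * Real.exp (ρ x) := by positivity
  have hpx := hp.contDiffAt
    ((isOpen_Ioi.prod isOpen_univ).mem_nhds
      (show (rhob * Real.exp (ρ x), s x) ∈ Set.Ioi (0 : ℝ) ×ˢ Set.univ from ⟨hr, trivial⟩))
  have hpos := hpmono _ hr (s x)
  have hcx : c x ≠ 0 := by
    rw [hcdef]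
    exact (Real.sqrt_pos.2 hpos).ne'
  have hρx : DifferentiableAt ℝ ρ x := (hρ.contDiffAt hU).differentiableAt (by simp)
  have hstate : DifferentiableAt ℝ (fun y => (rhob * Real.exp (ρ y), s y)) x :=
    (hρx.exp.const_mul rhob).prodMk (hsx.differentiableAt (by simp))
  have hc : DifferentiableAt ℝ c x := by
    rw [funext hcdef]
    have hd := (differentiableAt_deriv_fst p _ (hpx.of_le htwo)).comp x hstate
    exact DifferentiableAt.sqrt hd hpos.ne'
  refine exterior_derivative_inv_sq_mul_gradient c s x (fun y => glow (c y) (v y) (S y))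
    hc hcx (hsx.of_le htwo) ?_ α β
  filter_upwards [hU] with y hy γ
  exact glow_spatial_gradient (c y) (v y) (fun μ => pd s μ y) (S y) (hv0 y) (heuls y hy) (hS y) γ
end
end

section
/- Let φ : U → ℝ be smooth and define the energy–momentum tensor Q_{αβ}[φ] := ∂_α φ ∂_β φ - (1/2) g_{αβ} (g^{-1})^{κλ} ∂_κ φ ∂_λ φ. Then at every point of U: (i) 2 Q_{αβ}[φ] B^α B^β = (Bφ)² + c² Σ_{a=1}^{3} (∂_a φ)², where Bφ := B^μ ∂_μ φ. Moreover, (ii) if Z ∈ ℝ^4 is Σ_t-tangent (Z^0 = 0) with g(Z,Z) = 1 and L̲ := B - Z, then 2 Q_{αβ}[φ] B^α L̲^β = (L̲φ)² + (g̸^{-1})^{αβ} ∂_α φ ∂_β φ, where L̲φ := L̲^μ ∂_μ φ and (g̸^{-1})^{αβ} := (g^{-1})^{αβ} + B^α B^β - Z^α Z^β; and the quantity (g̸^{-1})^{αβ} ∂_α φ ∂_β φ is nonnegative. -/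
noncomputable section

open scoped BigOperators

/-- The energy–momentum tensor
`Q_{αβ}[φ] = ∂_αφ ∂_βφ - (1/2) g_{αβ} (g⁻¹)^{κλ} ∂_κφ ∂_λφ` at `x`. -/
def Qem (c : (Fin 4 → ℝ) → ℝ) (v : (Fin 4 → ℝ) → Fin 4 → ℝ)
    (φ : (Fin 4 → ℝ) → ℝ) (α β : Fin 4) (x : Fin 4 → ℝ) : ℝ :=
  pd φ α x * pd φ β x - (1 / 2) * gmet (c x) (v x) α β *
    ∑ κ : Fin 4, ∑ μ : Fin 4, ginv (c x) (v x) κ μ * pd φ κ x * pd φ μ x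

/-- The material vectorfield is `g`-unit timelike and `g`-orthogonal to `Σ_t`. -/
theorem gip_Bvec_sub (c : ℝ) (v Z : Fin 4 → ℝ) (hv : v 0 = 0) (hZ : Z 0 = 0) :
    gip c v (Bvec v) (fun β => Bvec v β - Z β) = -1 := by
  simp [gip, gmet, Bvec, spIdx, Fin.sum_univ_four, hv, hZ]
  ring

/-- The decomposition `g⁻¹ = -B ⊗ B + c² Σₐ ∂ₐ ⊗ ∂ₐ`, evaluated on a covector. -/
theorem sum_ginv_mul_mul (c : ℝ) (v p : Fin 4 → ℝ) (hv : v 0 = 0) :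
    ∑ κ : Fin 4, ∑ μ : Fin 4, ginv c v κ μ * p κ * p μ =
      -(∑ μ : Fin 4, Bvec v μ * p μ) ^ 2 + c ^ 2 * ∑ a ∈ spIdx, p a ^ 2 := by
  simp [ginv, Bvec, spIdx, Fin.sum_univ_four, hv]
  ring

/-- The quadratic form `g⁻¹ + B ⊗ B - Z ⊗ Z` evaluated on a covector. -/
theorem sum_ginv_add_sub_mul_mul (c : ℝ) (v Z p : Fin 4 → ℝ) (hv : v 0 = 0) :
    ∑ α : Fin 4, ∑ β : Fin 4,
        (ginv c v α β + Bvec v α * Bvec v β - Z α * Z β) * p α * p β =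
      c ^ 2 * ∑ a ∈ spIdx, p a ^ 2 - (∑ μ : Fin 4, Z μ * p μ) ^ 2 := by
  simp [ginv, Bvec, spIdx, Fin.sum_univ_four, hv]
  ring

/-- A `Σ_t`-tangent vector has `g`-length `c⁻¹` times its Euclidean length. -/
theorem gip_self_of_tangent (c : ℝ) (v Z : Fin 4 → ℝ) (hZ : Z 0 = 0) :
    gip c v Z Z = (∑ a ∈ spIdx, Z a ^ 2) / c ^ 2 := by
  simp [gip, gmet, spIdx, Fin.sum_univ_four, hZ]
  ring

/-- The contraction of the energy–momentum tensor with two vectors. -/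
theorem sum_Qem_mul_mul (c : (Fin 4 → ℝ) → ℝ) (v : (Fin 4 → ℝ) → Fin 4 → ℝ)
    (φ : (Fin 4 → ℝ) → ℝ) (x X Y : Fin 4 → ℝ) :
    ∑ α : Fin 4, ∑ β : Fin 4, Qem c v φ α β x * X α * Y β =
      (∑ μ : Fin 4, X μ * pd φ μ x) * (∑ μ : Fin 4, Y μ * pd φ μ x) -
        1 / 2 * gip (c x) (v x) X Y *
          ∑ κ : Fin 4, ∑ μ : Fin 4, ginv (c x) (v x) κ μ * pd φ κ x * pd φ μ x := by
  simp only [Qem, gip]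
  generalize ∑ κ : Fin 4, ∑ μ : Fin 4, ginv (c x) (v x) κ μ * pd φ κ x * pd φ μ x = S
  simp only [Fin.sum_univ_four]
  ring

/-- Contractions of the energy–momentum tensor:
(i) `2Q_{αβ}B^αB^β = (Bφ)² + c²Σₐ(∂ₐφ)²`;
(ii) for any unit `Σ_t`-tangent `Z` with `L̲ := B - Z`,
`2Q_{αβ}B^αL̲^β = (L̲φ)² + (g̸⁻¹)^{αβ}∂_αφ∂_βφ`, and the last term is
nonnegative. -/
theorem stmt19_energy_momentum_contractions
    (U : Set (Fin 4 → ℝ)) (hUopen : IsOpen U) (hUne : U.Nonempty)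
    (v : (Fin 4 → ℝ) → Fin 4 → ℝ) (c : (Fin 4 → ℝ) → ℝ)
    (hv : ContDiffOn ℝ (⊤ : ℕ∞) v U) (hc : ContDiffOn ℝ (⊤ : ℕ∞) c U)
    (hv0 : ∀ x, v x 0 = 0) (hcpos : ∀ x ∈ U, 0 < c x)
    (φ : (Fin 4 → ℝ) → ℝ) (hφ : ContDiffOn ℝ (⊤ : ℕ∞) φ U) :
    ∀ x ∈ U,
      (2 * (∑ α : Fin 4, ∑ β : Fin 4,
          Qem c v φ α β x * Bvec (v x) α * Bvec (v x) β)
        = (∑ μ : Fin 4, Bvec (v x) μ * pd φ μ x) ^ 2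
          + c x ^ 2 * ∑ a ∈ spIdx, pd φ a x ^ 2) ∧
      ∀ Z : Fin 4 → ℝ, Z 0 = 0 → gip (c x) (v x) Z Z = 1 →
        (2 * (∑ α : Fin 4, ∑ β : Fin 4,
            Qem c v φ α β x * Bvec (v x) α * (Bvec (v x) β - Z β))
          = (∑ μ : Fin 4, (Bvec (v x) μ - Z μ) * pd φ μ x) ^ 2
            + ∑ α : Fin 4, ∑ β : Fin 4,
                (ginv (c x) (v x) α β + Bvec (v x) α * Bvec (v x) β - Z α * Z β) *
                  pd φ α x * pd φ β x) ∧
        0 ≤ ∑ α : Fin 4, ∑ β : Fin 4,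
              (ginv (c x) (v x) α β + Bvec (v x) α * Bvec (v x) β - Z α * Z β) *
                pd φ α x * pd φ β x := by
  intro x hx
  have hv0x := hv0 x
  have hginv := sum_ginv_mul_mul (c x) (v x) (fun μ => pd φ μ x) hv0x
  refine ⟨?_, fun Z hZ0 hZ => ⟨?_, ?_⟩⟩
  · have hB : gip (c x) (v x) (Bvec (v x)) (Bvec (v x)) = -1 := by
      simpa using gip_Bvec_sub (c x) (v x) 0 hv0x rfl
    rw [sum_Qem_mul_mul, hB, hginv]
    ring
  · have hsub : ∑ μ : Fin 4, (Bvec (v x) μ - Z μ) * pd φ μ x =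
        ∑ μ : Fin 4, Bvec (v x) μ * pd φ μ x - ∑ μ : Fin 4, Z μ * pd φ μ x := by
      simp only [sub_mul, Finset.sum_sub_distrib]
    rw [sum_Qem_mul_mul c v φ x (Bvec (v x)) (fun β => Bvec (v x) β - Z β),
      gip_Bvec_sub _ _ _ hv0x hZ0, hginv,
      sum_ginv_add_sub_mul_mul (c x) (v x) Z (fun μ => pd φ μ x) hv0x, hsub]
    ring
  · have hsq : ∑ a ∈ spIdx, Z a ^ 2 = c x ^ 2 := by
      rw [gip_self_of_tangent _ _ _ hZ0] at hZ
      exact (div_eq_one_iff_eq (pow_ne_zero 2 (hcpos x hx).ne')).mp hZ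
    have hsum : ∑ μ : Fin 4, Z μ * pd φ μ x = ∑ a ∈ spIdx, Z a * pd φ a x := by
      simp [spIdx, Fin.sum_univ_four, hZ0, add_assoc]
    rw [sum_ginv_add_sub_mul_mul (c x) (v x) Z (fun μ => pd φ μ x) hv0x, hsum, ← hsq,
      sub_nonneg]
    exact Finset.sum_mul_sq_le_sq_mul_sq spIdx Z fun a => pd φ a x
end
end
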